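/- arXiv:2208.04288 — 5 statements merged into one kernel-verified Lean document; each statement's English description precedes it below -/
import Mathlib

section
/- Fix a ψ-twisted Feynman–Kac model. Then the updated marginal measures of the twisted model satisfy, for each p ∈ {0, …, n−1}, γ̂_p^ψ(S) = ∫_S M_{p+1}(ψ_{p+1})(x_p) γ̂_p(dx_p) for every measurable set S, and at the terminal time γ̂_n^ψ = γ̂_n as measures. -/
open MeasureTheory ProbabilityTheory ENNReal

noncomputable section

/-- A bounded, strictly positive, measurable `ℝ≥0∞`-valued function
(a potential or twisting function with values in `(0, ∞)`). -/
def BddPos {X : Type*} [MeasurableSpace X] (f : X → ℝ≥0∞) : Prop :=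
  Measurable f ∧ (∀ x, 0 < f x) ∧ ∃ C : ℝ≥0∞, C ≠ ⊤ ∧ ∀ x, f x ≤ C

/-- Predictive marginal measures `γ_p` of a Feynman–Kac model:
`γ_0 = M_0`, `γ_{p+1}(S) = ∫ γ_p(dx) G_p(x) M_{p+1}(x, S)`. -/
def fkGamma {X : Type*} [MeasurableSpace X] (M0 : Measure X)
    (M : ℕ → X → Measure X) (G : ℕ → X → ℝ≥0∞) : ℕ → Measure X
  | 0 => M0
  | p + 1 => ((fkGamma M0 M G p).withDensity (G p)).bind (M (p + 1))

/-- Updated marginal measures `γ̂_p(S) = ∫_S G_p(x) γ_p(dx)`. -/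
def fkGammaHat {X : Type*} [MeasurableSpace X] (M0 : Measure X)
    (M : ℕ → X → Measure X) (G : ℕ → X → ℝ≥0∞) (p : ℕ) : Measure X :=
  (fkGamma M0 M G p).withDensity (G p)

/-- The twist of a measure `μ` by a function `ψ` : `μ^ψ(dx) = μ(dx) ψ(x) / μ(ψ)`. -/
def fkTwist {X : Type*} [MeasurableSpace X] (μ : Measure X) (ψ : X → ℝ≥0∞) : Measure X :=
  (∫⁻ y, ψ y ∂μ)⁻¹ • μ.withDensity ψ

/-- The `ψ`-twisted potential functions `G_p^ψ` for a model with terminal time `n`: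
`G_0^ψ = (G_0/ψ_0) M_1(ψ_1) M_0(ψ_0)`, `G_p^ψ = (G_p/ψ_p) M_{p+1}(ψ_{p+1})` for
`1 ≤ p ≤ n-1`, and `G_n^ψ = G_n/ψ_n`. -/
def fkTwG {X : Type*} [MeasurableSpace X] (n : ℕ) (M0 : Measure X)
    (M : ℕ → X → Measure X) (G ψ : ℕ → X → ℝ≥0∞) (p : ℕ) (x : X) : ℝ≥0∞ :=
  G p x * (ψ p x)⁻¹ *
    (if p < n then ∫⁻ y, ψ (p + 1) y ∂(M (p + 1) x) else 1) *
    (if p = 0 then ∫⁻ y, ψ 0 y ∂M0 else 1)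

/-- Normalisation of a (finite, nonzero) measure. -/
def fkNorm {X : Type*} [MeasurableSpace X] (μ : Measure X) : Measure X :=
  (μ Set.univ)⁻¹ • μ

theorem BddPos.lintegral_ne_zero {X : Type*} [MeasurableSpace X] {f : X → ℝ≥0∞}
    (hf : BddPos f) (μ : Measure X) [NeZero μ] : ∫⁻ x, f x ∂μ ≠ 0 := by
  intro h
  rw [lintegral_eq_zero_iff hf.1] at h
  obtain ⟨x, hx⟩ := h.exists
  exact (hf.2.1 x).ne' hx

theorem BddPos.ne_top {X : Type*} [MeasurableSpace X] {f : X → ℝ≥0∞}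
    (hf : BddPos f) (x : X) : f x ≠ ⊤ := by
  obtain ⟨C, hC, hle⟩ := hf.2.2
  exact ne_top_of_le_ne_top hC (hle x)

theorem BddPos.lintegral_ne_top {X : Type*} [MeasurableSpace X] {f : X → ℝ≥0∞}
    (hf : BddPos f) (μ : Measure X) [IsFiniteMeasure μ] : ∫⁻ x, f x ∂μ ≠ ⊤ := by
  obtain ⟨C, hC, hle⟩ := hf.2.2
  refine ne_top_of_le_ne_top ?_ (lintegral_mono hle)
  rw [lintegral_const]
  exact ENNReal.mul_ne_top hC (measure_ne_top μ _)

theorem measurable_fkTwist {X Y : Type*} [MeasurableSpace X] [MeasurableSpace Y]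
    (κ : Kernel X Y) [IsSFiniteKernel κ] {ψ : Y → ℝ≥0∞} (hψ : Measurable ψ) :
    Measurable fun x => fkTwist (κ x) ψ := by
  refine Measure.measurable_of_measurable_coe _ fun S hS => ?_
  simp only [fkTwist, Measure.smul_apply, smul_eq_mul, withDensity_apply _ hS]
  exact hψ.lintegral_kernel.inv.mul (hψ.setLIntegral_kernel hS)

/-- Weighting by the normalising constants and then moving with the twisted kernel is the same
as moving with the original kernel and then weighting by the twisting function. -/
theorem withDensity_bind_fkTwist {X Y : Type*} [MeasurableSpace X] [MeasurableSpace Y]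
    (μ : Measure X) (κ : Kernel X Y) [IsMarkovKernel κ] {ψ : Y → ℝ≥0∞} (hψ : BddPos ψ) :
    (μ.withDensity fun x => ∫⁻ y, ψ y ∂(κ x)).bind (fun x => fkTwist (κ x) ψ)
      = (μ.bind κ).withDensity ψ := by
  ext S hS
  have hT := measurable_fkTwist κ hψ.1
  have hTS : Measurable fun x => fkTwist (κ x) ψ S := (Measure.measurable_coe hS).comp hT
  rw [Measure.bind_apply hS hT.aemeasurable,
    lintegral_withDensity_eq_lintegral_mul _ hψ.1.lintegral_kernel hTS,
    withDensity_apply _ hS, ← lintegral_indicator hS,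
    Measure.lintegral_bind κ.measurable.aemeasurable (hψ.1.indicator hS).aemeasurable]
  refine lintegral_congr fun x => ?_
  simp only [Pi.mul_apply, fkTwist, Measure.smul_apply, smul_eq_mul, withDensity_apply _ hS]
  rw [lintegral_indicator hS, ← mul_assoc,
    ENNReal.mul_inv_cancel (hψ.lintegral_ne_zero _) (hψ.lintegral_ne_top _), one_mul]

theorem fkGammaHat_twisted {X : Type*} [MeasurableSpace X] (n : ℕ)
    (M0 : Measure X) [IsProbabilityMeasure M0]
    (M : ℕ → Kernel X X) [∀ p, IsMarkovKernel (M p)]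
    (G ψ : ℕ → X → ℝ≥0∞)
    (hG : ∀ p ≤ n, BddPos (G p)) (hψ : ∀ p ≤ n, BddPos (ψ p)) (p : ℕ) (hp : p ≤ n) :
    fkGammaHat (fkTwist M0 (ψ 0)) (fun q x => fkTwist (M q x) (ψ q))
        (fkTwG n M0 (fun q x => M q x) G ψ) p
      = (fkGammaHat M0 (fun q x => M q x) G p).withDensity
          fun x => if p < n then ∫⁻ y, ψ (p + 1) y ∂(M (p + 1) x) else 1 := by
  have hH : ∀ p, Measurable fun x =>
      if p < n then ∫⁻ y, ψ (p + 1) y ∂(M (p + 1) x) else 1 := by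
    intro p
    split_ifs with h
    · exact (hψ (p + 1) h).1.lintegral_kernel
    · exact measurable_const
  have hTwG : ∀ p ≤ n, Measurable (fkTwG n M0 (fun q x => M q x) G ψ p) := fun p hp =>
    (((hG p hp).1.mul (hψ p hp).1.inv).mul (hH p)).mul measurable_const
  have hψG : ∀ p ≤ n, ∀ x, ψ p x * (G p x * (ψ p x)⁻¹) = G p x := fun p hp x => by
    rw [mul_left_comm, ENNReal.mul_inv_cancel ((hψ p hp).2.1 x).ne' ((hψ p hp).ne_top x), mul_one]
  induction p with
  | zero =>
    have h0 := (hψ 0 hp).lintegral_ne_zero M0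
    have h1 := (hψ 0 hp).lintegral_ne_top M0
    simp only [fkGammaHat, fkGamma, fkTwist]
    rw [withDensity_smul_measure, ← withDensity_mul _ (hψ 0 hp).1 (hTwG 0 hp),
      ← withDensity_mul _ (hG 0 hp).1 (hH 0),
      ← withDensity_smul _ ((hψ 0 hp).1.mul (hTwG 0 hp))]
    congr 1
    ext x
    simp only [Pi.smul_apply, Pi.mul_apply, smul_eq_mul, fkTwG, if_true]
    rw [← mul_assoc (ψ 0 x), ← mul_assoc (ψ 0 x), hψG 0 hp, mul_comm, mul_assoc,
      ENNReal.mul_inv_cancel h0 h1, mul_one]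
  | succ p ih =>
    have ih := ih (by omega)
    simp only [if_pos (show p < n from hp)] at ih
    unfold fkGammaHat at ih ⊢
    simp only [fkGamma]
    rw [ih, withDensity_bind_fkTwist _ (M (p + 1)) (hψ (p + 1) hp),
      ← withDensity_mul _ (hψ (p + 1) hp).1 (hTwG (p + 1) hp),
      ← withDensity_mul _ (hG (p + 1) hp).1 (hH (p + 1))]
    congr 1
    ext x
    simp only [Pi.mul_apply, fkTwG, if_neg (Nat.succ_ne_zero p), mul_one]
    rw [← mul_assoc (ψ (p + 1) x), hψG (p + 1) hp]

theorem twisted_updated_marginals {X : Type*} [MeasurableSpace X] (n : ℕ)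
    (M0 : Measure X) [IsProbabilityMeasure M0]
    (M : ℕ → Kernel X X) [∀ p, IsMarkovKernel (M p)]
    (G ψ : ℕ → X → ℝ≥0∞)
    (hG : ∀ p ≤ n, BddPos (G p)) (hψ : ∀ p ≤ n, BddPos (ψ p)) :
    (∀ p < n, ∀ S : Set X, MeasurableSet S →
      fkGammaHat (fkTwist M0 (ψ 0)) (fun q x => fkTwist (M q x) (ψ q))
          (fkTwG n M0 (fun q x => M q x) G ψ) p S
        = ∫⁻ x in S, (∫⁻ y, ψ (p + 1) y ∂(M (p + 1) x))
            ∂(fkGammaHat M0 (fun q x => M q x) G p)) ∧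
    fkGammaHat (fkTwist M0 (ψ 0)) (fun q x => fkTwist (M q x) (ψ q))
        (fkTwG n M0 (fun q x => M q x) G ψ) n
      = fkGammaHat M0 (fun q x => M q x) G n := by
  refine ⟨fun p hp S hS => ?_, ?_⟩
  · rw [fkGammaHat_twisted n M0 M G ψ hG hψ p hp.le, withDensity_apply _ hS]
    simp only [if_pos hp]
  · rw [fkGammaHat_twisted n M0 M G ψ hG hψ n le_rfl]
    simp only [lt_irrefl, if_false]
    exact withDensity_one

end
end

section
/- Define the optimal twisting functions recursively by ψ_n^* = G_n and ψ_p^* = G_p · M_{p+1}(ψ_{p+1}^*) for p = n−1, …, 0. Then M_0(ψ_0^*) equals the normalising constant of the model, i.e. M_0(ψ_0^*) = γ̂_n(X), the total mass of the terminal updated marginal measure. Consequently, for any points x_0, …, x_n ∈ X, the product of the twisted potentials satisfies ∏_{p=0}^{n} G_p^{ψ*}(x_p) = γ̂_n(X). -/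
open MeasureTheory ProbabilityTheory ENNReal

noncomputable section

def fkOptPsiAux {X : Type*} [MeasurableSpace X] (n : ℕ) (M : ℕ → X → Measure X)
    (G : ℕ → X → ℝ≥0∞) : ℕ → X → ℝ≥0∞
  | 0 => G n
  | k + 1 => fun x => G (n - (k + 1)) x * ∫⁻ y, fkOptPsiAux n M G k y ∂(M (n - k) x)

/-- The optimal twisting functions `ψ_p^⋆`, defined by the backward recursion
`ψ_n^⋆ = G_n` and `ψ_p^⋆ = G_p ⋅ M_{p+1}(ψ_{p+1}^⋆)` for `p = n-1, …, 0`. -/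
def fkOptPsi {X : Type*} [MeasurableSpace X] (n : ℕ) (M : ℕ → X → Measure X)
    (G : ℕ → X → ℝ≥0∞) (p : ℕ) : X → ℝ≥0∞ :=
  fkOptPsiAux n M G (n - p)

theorem BddPos.ne_zero {X : Type*} [MeasurableSpace X] {f : X → ℝ≥0∞} (hf : BddPos f) (x : X) :
    f x ≠ 0 :=
  (hf.2.1 x).ne'

theorem BddPos.mul {X : Type*} [MeasurableSpace X] {f g : X → ℝ≥0∞} (hf : BddPos f)
    (hg : BddPos g) : BddPos (fun x => f x * g x) := by
  obtain ⟨C, hC, hfC⟩ := hf.2.2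
  obtain ⟨D, hD, hgD⟩ := hg.2.2
  exact ⟨hf.1.mul hg.1, fun x => ENNReal.mul_pos (hf.ne_zero x) (hg.ne_zero x),
    C * D, ENNReal.mul_ne_top hC hD, fun x => mul_le_mul' (hfC x) (hgD x)⟩

theorem BddPos.lintegral_kernel {X : Type*} [MeasurableSpace X] {f : X → ℝ≥0∞} (hf : BddPos f)
    (κ : Kernel X X) [IsMarkovKernel κ] : BddPos (fun x => ∫⁻ y, f y ∂κ x) := by
  obtain ⟨C, hC, hfC⟩ := hf.2.2
  refine ⟨hf.1.lintegral_kernel, fun x => ?_, C, hC, fun x => ?_⟩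
  · rw [lintegral_pos_iff_support hf.1, Set.eq_univ_of_forall (s := Function.support f) hf.ne_zero]
    simp
  · calc ∫⁻ y, f y ∂κ x ≤ ∫⁻ _, C ∂κ x := lintegral_mono hfC
      _ = C := by simp

theorem fkOptPsi_self {X : Type*} [MeasurableSpace X] (n : ℕ) (M : ℕ → X → Measure X)
    (G : ℕ → X → ℝ≥0∞) : fkOptPsi n M G n = G n := by
  simp [fkOptPsi, fkOptPsiAux]

theorem fkOptPsi_of_lt {X : Type*} [MeasurableSpace X] {n p : ℕ} (hp : p < n)
    (M : ℕ → X → Measure X) (G : ℕ → X → ℝ≥0∞) :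
    fkOptPsi n M G p = fun x => G p x * ∫⁻ y, fkOptPsi n M G (p + 1) y ∂(M (p + 1) x) := by
  obtain ⟨k, rfl⟩ := Nat.exists_eq_add_of_lt hp
  have h₁ : p + k + 1 - p = k + 1 := by omega
  have h₂ : p + k + 1 - (p + 1) = k := by omega
  have h₃ : p + k + 1 - (k + 1) = p := by omega
  have h₄ : p + k + 1 - k = p + 1 := by omega
  simp only [fkOptPsi, h₁, h₂, fkOptPsiAux, h₃, h₄]

theorem bddPos_fkOptPsi {X : Type*} [MeasurableSpace X] {n : ℕ}
    (M : ℕ → Kernel X X) [∀ p, IsMarkovKernel (M p)] {G : ℕ → X → ℝ≥0∞}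
    (hG : ∀ p ≤ n, BddPos (G p)) {p : ℕ} (hp : p ≤ n) :
    BddPos (fkOptPsi n (fun q x => M q x) G p) := by
  induction hp using Nat.decreasingInduction with
  | self => exact fkOptPsi_self n _ G ▸ hG n le_rfl
  | of_succ p hp ih =>
    rw [fkOptPsi_of_lt hp]
    exact (hG p hp.le).mul (ih.lintegral_kernel (M (p + 1)))

theorem lintegral_fkOptPsi_fkGamma {X : Type*} [MeasurableSpace X] {n : ℕ} (M0 : Measure X)
    (M : ℕ → Kernel X X) [∀ p, IsMarkovKernel (M p)] {G : ℕ → X → ℝ≥0∞}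
    (hG : ∀ p ≤ n, BddPos (G p)) {p : ℕ} (hp : p ≤ n) :
    ∫⁻ y, fkOptPsi n (fun q x => M q x) G p y ∂(fkGamma M0 (fun q x => M q x) G p)
      = ∫⁻ y, fkOptPsi n (fun q x => M q x) G 0 y ∂M0 := by
  induction p with
  | zero => rfl
  | succ p ih =>
    have hψ := (bddPos_fkOptPsi M hG hp).1
    rw [← ih (by omega), fkOptPsi_of_lt hp, fkGamma,
      Measure.lintegral_bind (M (p + 1)).measurable.aemeasurable hψ.aemeasurable,
      lintegral_withDensity_eq_lintegral_mul _ (hG p (by omega)).1 hψ.lintegral_kernel]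
    rfl

theorem fkTwG_fkOptPsi {X : Type*} [MeasurableSpace X] {n : ℕ} (M0 : Measure X)
    (M : ℕ → Kernel X X) [∀ p, IsMarkovKernel (M p)] {G : ℕ → X → ℝ≥0∞}
    (hG : ∀ p ≤ n, BddPos (G p)) {p : ℕ} (hp : p ≤ n) (x : X) :
    fkTwG n M0 (fun q x => M q x) G (fkOptPsi n (fun q x => M q x) G) p x
      = if p = 0 then ∫⁻ y, fkOptPsi n (fun q x => M q x) G 0 y ∂M0 else 1 := by
  have hψ := bddPos_fkOptPsi M hG hp
  have hfactor : fkOptPsi n (fun q x => M q x) G p x = G p x *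
      (if p < n then ∫⁻ y, fkOptPsi n (fun q x => M q x) G (p + 1) y ∂(M (p + 1) x) else 1) := by
    split_ifs with h
    · rw [fkOptPsi_of_lt h]
    · rw [le_antisymm hp (not_lt.mp h), fkOptPsi_self, mul_one]
  rw [fkTwG, mul_right_comm (G p x), ← hfactor,
    ENNReal.mul_inv_cancel (hψ.ne_zero x) (hψ.ne_top x), one_mul]

theorem optimal_twisting_normalising_constant {X : Type*} [MeasurableSpace X] (n : ℕ)
    (M0 : Measure X) [IsProbabilityMeasure M0]
    (M : ℕ → Kernel X X) [∀ p, IsMarkovKernel (M p)]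
    (G : ℕ → X → ℝ≥0∞) (hG : ∀ p ≤ n, BddPos (G p)) :
    (∫⁻ y, fkOptPsi n (fun q x => M q x) G 0 y ∂M0
      = fkGammaHat M0 (fun q x => M q x) G n Set.univ) ∧
    (∀ x : ℕ → X,
      ∏ p ∈ Finset.range (n + 1),
          fkTwG n M0 (fun q x => M q x) G (fkOptPsi n (fun q x => M q x) G) p (x p)
        = fkGammaHat M0 (fun q x => M q x) G n Set.univ) := by
  have hZ : ∫⁻ y, fkOptPsi n (fun q x => M q x) G 0 y ∂M0
      = fkGammaHat M0 (fun q x => M q x) G n Set.univ := by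
    rw [← lintegral_fkOptPsi_fkGamma M0 M hG le_rfl, fkOptPsi_self, fkGammaHat,
      withDensity_apply _ MeasurableSet.univ, setLIntegral_univ]
  refine ⟨hZ, fun x => ?_⟩
  rw [← hZ, Finset.prod_congr rfl fun p hp =>
    fkTwG_fkOptPsi M0 M hG (Finset.mem_range_succ_iff.mp hp) (x p)]
  simp

end
end

section
/- For each p ∈ {0, …, n} and every bounded measurable function φ : X → ℝ, the random-weight model satisfies γ̃_p(φ ∘ π) = γ_p(φ), where π : X × U → X is the projection onto the first coordinate. In particular, taking φ ≡ 1 and p = n, the normalising constants agree: γ̃_n(X × U) = γ_n(X). -/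
open MeasureTheory ProbabilityTheory ENNReal

noncomputable section

/-- One step of the random-weight recursion preserves the form `γ ⊗ₘ K`. -/
theorem bind_withDensity_compProd {X U : Type*} [MeasurableSpace X] [MeasurableSpace U]
    (γ : Measure X) [SFinite γ] (M : Kernel X X) [IsMarkovKernel M]
    (K K' : Kernel X U) [IsMarkovKernel K] [IsMarkovKernel K']
    {g : X → ℝ≥0∞} {gt : X × U → ℝ≥0∞} (hg : Measurable g) (hgt : Measurable gt)
    (h : ∀ x, ∫⁻ u, gt (x, u) ∂(K x) = g x) :
    ((γ.compProd K).withDensity gt).bind (fun z => (M z.1).compProd K')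
      = ((γ.withDensity g).bind M).compProd K' := by
  have hmeas : Measurable fun x => (M x).compProd K' := by
    have heq : (fun x => (M x).compProd K') = M ⊗ₖ (Kernel.prodMkLeft X K') := by
      ext x s hs
      rw [Measure.compProd_apply hs, Kernel.compProd_apply hs]
      rfl
    rw [heq]
    exact Kernel.measurable _
  ext s hs
  have hF : Measurable fun x => (M x).compProd K' s := (Measure.measurable_coe hs).comp hmeas
  have hmeas' : Measurable fun z : X × U => (M z.1).compProd K' := hmeas.comp measurable_fst
  have hF' : Measurable fun z : X × U => (M z.1).compProd K' s := hF.comp measurable_fst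
  rw [Measure.bind_apply hs hmeas'.aemeasurable,
    lintegral_withDensity_eq_lintegral_mul _ hgt hF',
    Measure.lintegral_compProd (hgt.mul hF'),
    Measure.compProd_apply hs,
    Measure.lintegral_bind M.measurable.aemeasurable
      (Kernel.measurable_kernel_prodMk_left hs).aemeasurable,
    lintegral_withDensity_eq_lintegral_mul _ hg
      (Kernel.measurable_kernel_prodMk_left hs).lintegral_kernel]
  refine lintegral_congr fun x => ?_
  simp only [Pi.mul_apply]
  have hgx : Measurable fun u => gt (x, u) := hgt.comp measurable_prodMk_left
  rw [lintegral_mul_const _ hgx, h, Measure.compProd_apply hs]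

theorem sFinite_fkGamma {X : Type*} [MeasurableSpace X] (M0 : Measure X) [SFinite M0]
    (M : ℕ → Kernel X X) [∀ p, IsSFiniteKernel (M p)] (G : ℕ → X → ℝ≥0∞) (p : ℕ) :
    SFinite (fkGamma M0 (fun q x => M q x) G p) := by
  induction p with
  | zero => assumption
  | succ p ih =>
    change SFinite (((fkGamma M0 (fun q x => M q x) G p).withDensity (G p)).bind (M (p + 1)))
    infer_instance

theorem random_weight_marginal_expectations {X U : Type*} [MeasurableSpace X] [MeasurableSpace U] (n : ℕ)
    (M0 : Measure X) [IsProbabilityMeasure M0]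
    (M : ℕ → Kernel X X) [∀ p, IsMarkovKernel (M p)]
    (K : ℕ → Kernel X U) [∀ p, IsMarkovKernel (K p)]
    (G : ℕ → X → ℝ≥0∞) (Gt : ℕ → X × U → ℝ≥0∞)
    (hG : ∀ p ≤ n, BddPos (G p)) (hGt : ∀ p ≤ n, BddPos (Gt p))
    (hunb : ∀ p ≤ n, ∀ x : X, ∫⁻ u, Gt p (x, u) ∂(K p x) = G p x) :
    (∀ p ≤ n, ∀ φ : X → ℝ, Measurable φ → (∃ C : ℝ, ∀ x, |φ x| ≤ C) →
      ∫ z, φ z.1 ∂(fkGamma (M0.compProd (K 0)) (fun q z => (M q z.1).compProd (K q)) Gt p)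
        = ∫ x, φ x ∂(fkGamma M0 (fun q x => M q x) G p)) ∧
    fkGamma (M0.compProd (K 0)) (fun q z => (M q z.1).compProd (K q)) Gt n Set.univ
      = fkGamma M0 (fun q x => M q x) G n Set.univ := by
  have hs : ∀ p, SFinite (fkGamma M0 (fun q x => M q x) G p) := sFinite_fkGamma M0 M G
  have key : ∀ p ≤ n,
      fkGamma (M0.compProd (K 0)) (fun q z => (M q z.1).compProd (K q)) Gt p
        = (fkGamma M0 (fun q x => M q x) G p).compProd (K p) := by
    intro p
    induction p with
    | zero => intro _; rfl
    | succ p ih =>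
      intro hp
      have hp' : p ≤ n := by omega
      simp only [fkGamma]
      rw [ih hp']
      exact bind_withDensity_compProd _ (M (p + 1)) (K p) (K (p + 1))
        (hG p hp').1 (hGt p hp').1 (hunb p hp')
  have hfst : ∀ p ≤ n,
      (fkGamma (M0.compProd (K 0)) (fun q z => (M q z.1).compProd (K q)) Gt p).map Prod.fst
        = fkGamma M0 (fun q x => M q x) G p := by
    intro p hp
    rw [key p hp]
    exact Measure.fst_compProd _ _
  refine ⟨fun p hp φ hφ _ => ?_, ?_⟩
  · rw [← hfst p hp, integral_map measurable_fst.aemeasurable hφ.aestronglyMeasurable]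
  · rw [← hfst n le_rfl, Measure.map_apply measurable_fst MeasurableSet.univ, Set.preimage_univ]

end
end

section
/- Define s_p(x) = ∫_U (G̃_p(x, u)/G_p(x))² K_p(x, du) for p ∈ {0, …, n−1}, and s_n ≡ 1. Then for every bounded measurable φ : X → ℝ and each p ∈ {0, …, n}, writing (φ ⊗ 1)(x, u) = φ(x), one has γ̃_p( (Q̃_{p,n}(φ ⊗ 1))² ) = γ_p( s_p · (Q_{p,n}(φ))² ). Consequently, the quantity v̄_{p,n}(φ) := γ_p(X) γ̃_p((Q̃_{p,n}(φ⊗1))²)/γ_n(X)² − η_n(φ)² equals γ_p(X) γ_p(s_p · Q_{p,n}(φ)²)/γ_n(X)² − η_n(φ)². -/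
open MeasureTheory ProbabilityTheory ENNReal

noncomputable section

/-- The nonnegative kernel `Q_p(x, dy) = G_{p-1}(x) M_p(x, dy)`. -/
def fkQ {X : Type*} [MeasurableSpace X] (M : ℕ → X → Measure X)
    (G : ℕ → X → ℝ≥0∞) (p : ℕ) (x : X) : Measure X :=
  G (p - 1) x • M p x

def fkQProdAux {X : Type*} [MeasurableSpace X] (M : ℕ → X → Measure X)
    (G : ℕ → X → ℝ≥0∞) (n : ℕ) : ℕ → X → Measure X
  | 0 => fun x => Measure.dirac x
  | k + 1 => fun x => (fkQ M G (n - k) x).bind (fkQProdAux M G n k)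

/-- The product kernel `Q_{p,n} = Q_{p+1} ⋯ Q_n` (with `Q_{n,n} = Id`). -/
def fkQProd {X : Type*} [MeasurableSpace X] (M : ℕ → X → Measure X)
    (G : ℕ → X → ℝ≥0∞) (n p : ℕ) : X → Measure X :=
  fkQProdAux M G n (n - p)

/-- The relative second moment `s_p(x) = ∫_U (G̃_p(x,u)/G_p(x))² K_p(x, du)` for
`p < n`, with `s_n ≡ 1`. -/
def rwS {X U : Type*} [MeasurableSpace X] [MeasurableSpace U] (n : ℕ)
    (K : ℕ → Kernel X U) (G : ℕ → X → ℝ≥0∞) (Gt : ℕ → X × U → ℝ≥0∞)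
    (p : ℕ) (x : X) : ℝ≥0∞ :=
  if p < n then ∫⁻ u, (Gt p (x, u) / G p x) ^ 2 ∂(K p x) else 1

section FeynmanKac

variable {X : Type*} [MeasurableSpace X]

lemma measurable_fkQ {M : ℕ → X → Measure X} {G : ℕ → X → ℝ≥0∞} {p : ℕ}
    (hM : Measurable (M p)) (hG : Measurable (G (p - 1))) : Measurable (fkQ M G p) := by
  refine Measure.measurable_of_measurable_coe _ fun s hs => ?_
  simp only [fkQ, Measure.smul_apply, smul_eq_mul]
  exact hG.mul (Measure.measurable_coe hs |>.comp hM)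

lemma measurable_fkQProdAux {M : ℕ → X → Measure X} {G : ℕ → X → ℝ≥0∞} {n : ℕ}
    (hM : ∀ p, Measurable (M p)) (hG : ∀ p ≤ n, Measurable (G p)) (k : ℕ) :
    Measurable (fkQProdAux M G n k) := by
  induction k with
  | zero => exact Measure.measurable_dirac
  | succ k ih =>
    exact (Measure.measurable_bind' ih).comp (measurable_fkQ (hM _) (hG _ (by omega)))

lemma lintegral_fkQProdAux_succ {M : ℕ → X → Measure X} {G : ℕ → X → ℝ≥0∞} {n : ℕ}
    (hM : ∀ p, Measurable (M p)) (hG : ∀ p ≤ n, Measurable (G p)) (k : ℕ) (x : X)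
    {f : X → ℝ≥0∞} (hf : Measurable f) :
    ∫⁻ y, f y ∂(fkQProdAux M G n (k + 1) x) =
      G (n - (k + 1)) x * ∫⁻ y, ∫⁻ w, f w ∂(fkQProdAux M G n k y) ∂(M (n - k) x) := by
  rw [fkQProdAux, Measure.lintegral_bind (measurable_fkQProdAux hM hG k).aemeasurable
    hf.aemeasurable, fkQ, lintegral_smul_measure, smul_eq_mul]
  rfl

lemma fkGamma_isFiniteMeasure {M0 : Measure X} [IsFiniteMeasure M0] {M : ℕ → Kernel X X}
    [∀ p, IsFiniteKernel (M p)] {G : ℕ → X → ℝ≥0∞} {n : ℕ} (hG : ∀ p ≤ n, BddPos (G p)) :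
    ∀ p ≤ n, IsFiniteMeasure (fkGamma M0 (fun q x => M q x) G p)
  | 0, _ => ‹IsFiniteMeasure M0›
  | p + 1, hp => by
    have := fkGamma_isFiniteMeasure hG p (by omega) (M0 := M0) (M := M)
    obtain ⟨-, -, C, hC, hle⟩ := hG p (by omega)
    have : IsFiniteMeasure ((fkGamma M0 (fun q x => M q x) G p).withDensity (G p)) :=
      isFiniteMeasure_withDensity ((lintegral_mono hle).trans_lt (by
        rw [lintegral_const]; exact ENNReal.mul_lt_top hC.lt_top (measure_lt_top _ _))).ne
    rw [fkGamma]
    change IsFiniteMeasure (Measure.bind _ (M (p + 1)))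
    infer_instance

end FeynmanKac

section RandomWeight

variable {X U : Type*} [MeasurableSpace X] [MeasurableSpace U]

lemma measurable_compProd_comp_fst (κ : Kernel X X) [IsSFiniteKernel κ] (η : Kernel X U)
    [IsSFiniteKernel η] : Measurable fun z : X × U => (κ z.1).compProd η := by
  refine Measure.measurable_of_measurable_coe _ fun s hs => ?_
  simp only [Measure.compProd_apply hs]
  exact (Kernel.measurable_kernel_prodMk_left hs).lintegral_kernel.comp measurable_fst

lemma lintegral_sq_potential {n : ℕ} {K : ℕ → Kernel X U} {G : ℕ → X → ℝ≥0∞}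
    {Gt : ℕ → X × U → ℝ≥0∞} (hG : ∀ p ≤ n, BddPos (G p))
    (hGt : ∀ p ≤ n, BddPos (Gt p))
    {p : ℕ} (hp : p < n) (x : X) :
    ∫⁻ u, Gt p (x, u) ^ 2 ∂(K p x) = rwS n K G Gt p x * G p x ^ 2 := by
  obtain ⟨-, hpos, C, hC, hle⟩ := hG p hp.le
  have h0 : G p x ≠ 0 := (hpos x).ne'
  have ht : G p x ≠ ⊤ := ((hle x).trans_lt hC.lt_top).ne
  have hsec : Measurable fun u => Gt p (x, u) := (hGt p hp.le).1.comp measurable_prodMk_left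
  rw [rwS, if_pos hp, ← lintegral_mul_const _ ((hsec.div_const _).pow_const 2)]
  refine lintegral_congr fun u => ?_
  rw [← mul_pow, ENNReal.div_mul_cancel h0 ht]

variable {n : ℕ} {M : ℕ → Kernel X X} [∀ p, IsMarkovKernel (M p)]
  {K : ℕ → Kernel X U} [∀ p, IsMarkovKernel (K p)]
  {G : ℕ → X → ℝ≥0∞} {Gt : ℕ → X × U → ℝ≥0∞}

/-- Averaging the random-weight product kernel over the auxiliary variable gives the
original product kernel. -/
lemma lintegral_fkQProdAux_randomWeight
    (hG : ∀ p ≤ n, Measurable (G p)) (hGt : ∀ p ≤ n, Measurable (Gt p))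
    (hunb : ∀ p ≤ n, ∀ x : X, ∫⁻ u, Gt p (x, u) ∂(K p x) = G p x)
    {f : X → ℝ≥0∞} (hf : Measurable f) (k : ℕ) (x : X) :
    ∫⁻ u, ∫⁻ w, f w.1
        ∂(fkQProdAux (fun q z => (M q z.1).compProd (K q)) Gt n k (x, u)) ∂(K (n - k) x) =
      ∫⁻ y, f y ∂(fkQProdAux (fun q x => M q x) G n k x) := by
  have hMt : ∀ q, Measurable fun z : X × U => (M q z.1).compProd (K q) :=
    fun q => measurable_compProd_comp_fst (M q) (K q)
  have hf1 : Measurable fun w : X × U => f w.1 := hf.comp measurable_fst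
  induction k generalizing x with
  | zero =>
    simp only [fkQProdAux]
    simp [lintegral_dirac' _ hf1, lintegral_dirac' _ hf]
  | succ k ih =>
    have hmeas : Measurable fun y =>
        ∫⁻ w, f w.1 ∂(fkQProdAux (fun q z => (M q z.1).compProd (K q)) Gt n k y) :=
      (Measure.measurable_lintegral hf1).comp (measurable_fkQProdAux hMt hGt k)
    rw [lintegral_fkQProdAux_succ (fun q => (M q).measurable) hG k x hf]
    simp only [lintegral_fkQProdAux_succ hMt hGt k _ hf1, Measure.lintegral_compProd hmeas, ih]
    have hsec : Measurable fun u => Gt (n - (k + 1)) (x, u) :=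
      (hGt _ (by omega)).comp measurable_prodMk_left
    rw [lintegral_mul_const _ hsec, hunb _ (by omega)]

lemma map_fst_fkQProdAux_succ
    (hG : ∀ p ≤ n, Measurable (G p)) (hGt : ∀ p ≤ n, Measurable (Gt p))
    (hunb : ∀ p ≤ n, ∀ x : X, ∫⁻ u, Gt p (x, u) ∂(K p x) = G p x) (k : ℕ) (z : X × U) :
    (fkQProdAux (fun q z => (M q z.1).compProd (K q)) Gt n (k + 1) z).map Prod.fst =
      Gt (n - (k + 1)) z • (M (n - k) z.1).bind (fkQProdAux (fun q x => M q x) G n k) := by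
  have hMt : ∀ q, Measurable fun z : X × U => (M q z.1).compProd (K q) :=
    fun q => measurable_compProd_comp_fst (M q) (K q)
  refine Measure.ext_of_lintegral _ fun f hf => ?_
  have hf1 : Measurable fun w : X × U => f w.1 := hf.comp measurable_fst
  have hmeas : Measurable fun y =>
      ∫⁻ w, f w.1 ∂(fkQProdAux (fun q z => (M q z.1).compProd (K q)) Gt n k y) :=
    (Measure.measurable_lintegral hf1).comp (measurable_fkQProdAux hMt hGt k)
  rw [lintegral_map hf measurable_fst, lintegral_fkQProdAux_succ hMt hGt k _ hf1,
    Measure.lintegral_compProd hmeas, lintegral_smul_measure, smul_eq_mul,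
    Measure.lintegral_bind
      (measurable_fkQProdAux (fun q => (M q).measurable) hG k).aemeasurable hf.aemeasurable]
  simp only [lintegral_fkQProdAux_randomWeight hG hGt hunb hf]

lemma fkGamma_randomWeight {M0 : Measure X} [IsFiniteMeasure M0]
    (hG : ∀ p ≤ n, BddPos (G p)) (hGt : ∀ p ≤ n, BddPos (Gt p))
    (hunb : ∀ p ≤ n, ∀ x : X, ∫⁻ u, Gt p (x, u) ∂(K p x) = G p x) (p : ℕ) (hp : p ≤ n) :
    fkGamma (M0.compProd (K 0)) (fun q z => (M q z.1).compProd (K q)) Gt p =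
      (fkGamma M0 (fun q x => M q x) G p).compProd (K p) := by
  induction p with
  | zero => rfl
  | succ p ih =>
    have hp' : p ≤ n := by omega
    have := fkGamma_isFiniteMeasure hG p hp' (M0 := M0) (M := M)
    have := fkGamma_isFiniteMeasure hG (p + 1) hp (M0 := M0) (M := M)
    refine Measure.ext_of_lintegral _ fun f hf => ?_
    have hMt := measurable_compProd_comp_fst (M (p + 1)) (K (p + 1))
    have hinner : Measurable fun x => ∫⁻ u, f (x, u) ∂(K (p + 1) x) :=
      hf.lintegral_kernel_prod_right'
    have houter : Measurable fun x => ∫⁻ y, ∫⁻ u, f (y, u) ∂(K (p + 1) y) ∂(M (p + 1) x) :=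
      hinner.lintegral_kernel
    rw [Measure.lintegral_compProd hf, fkGamma, ih hp', fkGamma,
      Measure.lintegral_bind hMt.aemeasurable hf.aemeasurable,
      Measure.lintegral_bind (M (p + 1)).measurable.aemeasurable hinner.aemeasurable]
    simp only [Measure.lintegral_compProd hf]
    have houter1 : Measurable fun z : X × U =>
        ∫⁻ y, ∫⁻ u, f (y, u) ∂(K (p + 1) y) ∂(M (p + 1) z.1) := houter.comp measurable_fst
    rw [lintegral_withDensity_eq_lintegral_mul _ (hGt p hp').1 houter1,
      lintegral_withDensity_eq_lintegral_mul _ (hG p hp').1 houter,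
      Measure.lintegral_compProd ((hGt p hp').1.mul houter1)]
    refine lintegral_congr fun x => ?_
    have hsec : Measurable fun u => Gt p (x, u) := (hGt p hp').1.comp measurable_prodMk_left
    simp only [Pi.mul_apply]
    rw [lintegral_mul_const _ hsec, hunb p hp' x]

end RandomWeight

theorem random_weight_second_moments {X U : Type*} [MeasurableSpace X] [MeasurableSpace U] (n : ℕ)
    (M0 : Measure X) [IsProbabilityMeasure M0]
    (M : ℕ → Kernel X X) [∀ p, IsMarkovKernel (M p)]
    (K : ℕ → Kernel X U) [∀ p, IsMarkovKernel (K p)]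
    (G : ℕ → X → ℝ≥0∞) (Gt : ℕ → X × U → ℝ≥0∞)
    (hG : ∀ p ≤ n, BddPos (G p)) (hGt : ∀ p ≤ n, BddPos (Gt p))
    (hunb : ∀ p ≤ n, ∀ x : X, ∫⁻ u, Gt p (x, u) ∂(K p x) = G p x)
    (hs : ∀ p ≤ n, ∀ x : X, rwS n K G Gt p x ≠ ⊤)
    (hZ : 0 < fkGamma M0 (fun q x => M q x) G n Set.univ) :
    ∀ p ≤ n, ∀ φ : X → ℝ, Measurable φ → (∃ C : ℝ, ∀ x, |φ x| ≤ C) →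
      (∫ z, (∫ w, φ w.1 ∂(fkQProd (fun q z => (M q z.1).compProd (K q)) Gt n p z)) ^ 2
          ∂(fkGamma (M0.compProd (K 0)) (fun q z => (M q z.1).compProd (K q)) Gt p)
        = ∫ x, (rwS n K G Gt p x).toReal *
            (∫ y, φ y ∂(fkQProd (fun q x => M q x) G n p x)) ^ 2
            ∂(fkGamma M0 (fun q x => M q x) G p)) ∧
      ((fkGamma M0 (fun q x => M q x) G p Set.univ).toReal *
            (∫ z, (∫ w, φ w.1 ∂(fkQProd (fun q z => (M q z.1).compProd (K q)) Gt n p z)) ^ 2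
              ∂(fkGamma (M0.compProd (K 0)) (fun q z => (M q z.1).compProd (K q)) Gt p)) /
            (fkGamma M0 (fun q x => M q x) G n Set.univ).toReal ^ 2
          - (∫ x, φ x ∂(fkNorm (fkGamma M0 (fun q x => M q x) G n))) ^ 2
        = (fkGamma M0 (fun q x => M q x) G p Set.univ).toReal *
              (∫ x, (rwS n K G Gt p x).toReal *
                (∫ y, φ y ∂(fkQProd (fun q x => M q x) G n p x)) ^ 2
                ∂(fkGamma M0 (fun q x => M q x) G p)) /
              (fkGamma M0 (fun q x => M q x) G n Set.univ).toReal ^ 2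
          - (∫ x, φ x ∂(fkNorm (fkGamma M0 (fun q x => M q x) G n))) ^ 2) := by
  intro p hp φ hφ _
  refine (fun h => ⟨h, by rw [h]⟩) ?_
  have hGm : ∀ p ≤ n, Measurable (G p) := fun p hp => (hG p hp).1
  have hGtm : ∀ p ≤ n, Measurable (Gt p) := fun p hp => (hGt p hp).1
  have := fkGamma_isFiniteMeasure hG p hp (M0 := M0) (M := M)
  rw [fkGamma_randomWeight hG hGt hunb p hp]
  have hφ1 : StronglyMeasurable fun w : X × U => φ w.1 :=
    (hφ.comp measurable_fst).stronglyMeasurable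
  rcases hp.eq_or_lt with rfl | hlt
  · simp only [fkQProd, Nat.sub_self, fkQProdAux, integral_dirac' _ _ hφ1,
      integral_dirac' _ _ hφ.stronglyMeasurable, rwS, lt_irrefl, if_false, toReal_one, one_mul]
    conv_rhs => rw [← Measure.fst_compProd (fkGamma M0 (fun q x => M q x) G p) (K p),
      Measure.fst, integral_map measurable_fst.aemeasurable
        (hφ.pow_const 2).aestronglyMeasurable]
  · obtain ⟨k, hk⟩ : ∃ k, n - p = k + 1 := ⟨n - p - 1, by omega⟩
    have hkp : n - (k + 1) = p := by omega
    let Q : Kernel X X :=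
      ⟨fkQProdAux (fun q x => M q x) G n k,
        measurable_fkQProdAux (fun q => (M q).measurable) hGm k⟩
    let I : X → ℝ := fun x => ∫ y, φ y ∂((Q ∘ₖ M (n - k)) x)
    have hIm : Measurable I := (hφ.stronglyMeasurable.integral_kernel).measurable
    have htilde : ∀ z : X × U,
        ∫ w, φ w.1 ∂(fkQProd (fun q z => (M q z.1).compProd (K q)) Gt n p z) =
          (Gt p z).toReal * I z.1 := fun z => by
      rw [fkQProd, hk, ← integral_map (φ := Prod.fst) (f := φ) measurable_fst.aemeasurable
        hφ.aestronglyMeasurable, map_fst_fkQProdAux_succ hGm hGtm hunb, hkp,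
        integral_smul_measure, smul_eq_mul]
      rfl
    have horig : ∀ x, ∫ y, φ y ∂(fkQProd (fun q x => M q x) G n p x) =
        (G p x).toReal * I x := fun x => by
      have : fkQProdAux (fun q x => M q x) G n (k + 1) x =
          G p x • (Q ∘ₖ M (n - k)) x := by
        refine Measure.ext_of_lintegral _ fun f hf => ?_
        rw [lintegral_fkQProdAux_succ (fun q => (M q).measurable) hGm k x hf, hkp,
          lintegral_smul_measure, smul_eq_mul, Kernel.lintegral_comp _ _ _ hf]
        rfl
      rw [fkQProd, hk, this, integral_smul_measure, smul_eq_mul]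
    have hsm : Measurable (rwS n K G Gt p) := by
      have : Measurable fun z : X × U => (Gt p z / G p z.1) ^ 2 :=
        ((hGtm p hp).div ((hGm p hp).comp measurable_fst)).pow_const 2
      convert this.lintegral_kernel_prod_right' (κ := K p) using 2 with x
      rw [rwS, if_pos hlt]
    have hsq : Measurable fun z : X × U => ((Gt p z).toReal * I z.1) ^ 2 :=
      ((hGtm p hp).ennreal_toReal.mul (hIm.comp measurable_fst)).pow_const 2
    have hsq' : Measurable fun x => (rwS n K G Gt p x).toReal * ((G p x).toReal * I x) ^ 2 :=
      hsm.ennreal_toReal.mul (((hGm p hp).ennreal_toReal.mul hIm).pow_const 2)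
    simp only [htilde, horig]
    rw [integral_eq_lintegral_of_nonneg_ae (ae_of_all _ fun z => sq_nonneg _)
        hsq.aestronglyMeasurable,
      integral_eq_lintegral_of_nonneg_ae
        (ae_of_all _ fun x => mul_nonneg toReal_nonneg (sq_nonneg _))
        hsq'.aestronglyMeasurable,
      Measure.lintegral_compProd hsq.ennreal_ofReal]
    congr 1
    refine lintegral_congr fun x => ?_
    obtain ⟨-, -, C, hC, hle⟩ := hG p hp
    obtain ⟨-, -, D, hD, hle'⟩ := hGt p hp
    have hGx : G p x ≠ ⊤ := ((hle x).trans_lt hC.lt_top).ne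
    have hGtx : ∀ u, Gt p (x, u) ≠ ⊤ := fun u => ((hle' _).trans_lt hD.lt_top).ne
    have hsec : Measurable fun u => Gt p (x, u) := (hGtm p hp).comp measurable_prodMk_left
    simp only [mul_pow]
    rw [ofReal_mul toReal_nonneg, ofReal_mul (sq_nonneg _), ofReal_toReal (hs p hp x),
      ofReal_pow toReal_nonneg, ofReal_toReal hGx, ← mul_assoc,
      ← lintegral_sq_potential hG hGt hlt x,
      ← lintegral_mul_const _ (hsec.pow_const 2)]
    refine lintegral_congr fun u => ?_
    rw [ofReal_mul (sq_nonneg _), ofReal_pow toReal_nonneg, ofReal_toReal (hGtx u)]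

end
end

section
/- Define s_p(x) = ∫_U (G̃_p(x, u)/G_p(x))² K_p(x, du) for p ∈ {0, …, n−1} and s_n ≡ 1, and suppose sup_{p ∈ {0,…,n}} sup_{x ∈ X} s_p(x) ≤ C + 1 for some 0 < C < ∞. Let σ̄_n²(1) = Σ_{p=0}^{n} v̄_{p,n}(1) and σ_n²(1) = Σ_{p=0}^{n} v_{p,n}(1), where v̄_{p,n}(φ) = γ_p(X) γ_p(s_p · Q_{p,n}(φ)²)/γ_n(X)² − η_n(φ)² and v_{p,n}(φ) = γ_p(X) γ_p(Q_{p,n}(φ)²)/γ_n(X)² − η_n(φ)², evaluated at the constant function φ = 1. Then σ̄_n²(1) ≤ (C+1) σ_n²(1) + nC. -/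
open MeasureTheory ProbabilityTheory ENNReal

noncomputable section

/-- The measures `γ_p`, `p ≤ n`, are finite when the potentials are bounded. -/
theorem fkGamma_univ_lt_top {X : Type*} [MeasurableSpace X] {n : ℕ}
    (M0 : Measure X) [IsProbabilityMeasure M0]
    (M : ℕ → Kernel X X) [∀ p, IsMarkovKernel (M p)] {G : ℕ → X → ℝ≥0∞}
    (hG : ∀ p ≤ n, BddPos (G p)) (p : ℕ) (hp : p ≤ n) :
    fkGamma M0 (fun q x => M q x) G p Set.univ < ⊤ := by
  induction p with
  | zero => simp [fkGamma]
  | succ p ih =>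
    obtain ⟨-, -, c, hc, hle⟩ := hG p (by omega)
    have hfin := ih (by omega)
    rw [fkGamma, Measure.bind_apply MeasurableSet.univ (M (p + 1)).measurable.aemeasurable]
    simp only [measure_univ, lintegral_const, one_mul, withDensity_apply _ MeasurableSet.univ,
      Measure.restrict_univ]
    calc ∫⁻ x, G p x ∂(fkGamma M0 (fun q x => M q x) G p)
        ≤ ∫⁻ _, c ∂(fkGamma M0 (fun q x => M q x) G p) := lintegral_mono hle
      _ < ⊤ := by
        rw [lintegral_const]
        exact ENNReal.mul_lt_top hc.lt_top hfin

theorem measurable_fkQ_s17 {X : Type*} [MeasurableSpace X]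
    (M : ℕ → Kernel X X) {G : ℕ → X → ℝ≥0∞} {p : ℕ} (hG : Measurable (G (p - 1))) :
    Measurable (fkQ (fun q x => M q x) G p) := by
  refine Measure.measurable_of_measurable_coe _ fun s hs => ?_
  simp only [fkQ, Measure.smul_apply, smul_eq_mul]
  exact hG.mul ((M p).measurable_coe hs)

/-- The product kernels are measurable and have uniformly bounded mass. -/
theorem fkQProdAux_measurable_and_bounded {X : Type*} [MeasurableSpace X] {n : ℕ}
    (M : ℕ → Kernel X X) [∀ p, IsMarkovKernel (M p)] {G : ℕ → X → ℝ≥0∞}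
    (hG : ∀ p ≤ n, BddPos (G p)) (k : ℕ) :
    Measurable (fkQProdAux (fun q x => M q x) G n k) ∧
      ∃ B : ℝ≥0∞, B ≠ ⊤ ∧ ∀ x, fkQProdAux (fun q x => M q x) G n k x Set.univ ≤ B := by
  induction k with
  | zero => exact ⟨Measure.measurable_dirac, 1, one_ne_top, fun x => by simp [fkQProdAux]⟩
  | succ k ih =>
    obtain ⟨hmeas, B, hB, hle⟩ := ih
    obtain ⟨hGm, -, c, hc, hGle⟩ := hG (n - k - 1) (by omega)
    refine ⟨(Measure.measurable_bind' hmeas).comp (measurable_fkQ_s17 M hGm), B * c,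
      ENNReal.mul_ne_top hB hc, fun x => ?_⟩
    rw [fkQProdAux, Measure.bind_apply MeasurableSet.univ hmeas.aemeasurable]
    refine (lintegral_mono hle).trans ?_
    simp only [lintegral_const, fkQ, Measure.smul_apply, measure_univ, smul_eq_mul, mul_one]
    gcongr
    exact hGle x

/-- The squared total mass of `Q_{p,n}` is integrable against every finite measure. -/
theorem integrable_sq_integral_fkQProd {X : Type*} [MeasurableSpace X] {n : ℕ}
    (M : ℕ → Kernel X X) [∀ p, IsMarkovKernel (M p)] {G : ℕ → X → ℝ≥0∞}
    (hG : ∀ p ≤ n, BddPos (G p)) (p : ℕ) (μ : Measure X) [IsFiniteMeasure μ] :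
    Integrable (fun x => (∫ _, (1 : ℝ) ∂(fkQProd (fun q x => M q x) G n p x)) ^ 2) μ := by
  obtain ⟨hmeas, B, hB, hle⟩ := fkQProdAux_measurable_and_bounded M hG (n - p)
  have hmass : Measurable fun x => (fkQProd (fun q x => M q x) G n p x Set.univ).toReal :=
    ((Measure.measurable_coe MeasurableSet.univ).comp hmeas).ennreal_toReal
  simp only [integral_const, smul_eq_mul, mul_one, Measure.real]
  refine Integrable.of_bound (hmass.pow_const 2).aestronglyMeasurable (B.toReal ^ 2)
    (Filter.Eventually.of_forall fun x => ?_)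
  rw [Real.norm_of_nonneg (by positivity)]
  gcongr
  exact hle x

theorem random_weight_asymptotic_variance_normalising_constant {X U : Type*} [MeasurableSpace X] [MeasurableSpace U] (n : ℕ)
    (M0 : Measure X) [IsProbabilityMeasure M0]
    (M : ℕ → Kernel X X) [∀ p, IsMarkovKernel (M p)]
    (K : ℕ → Kernel X U) [∀ p, IsMarkovKernel (K p)]
    (G : ℕ → X → ℝ≥0∞) (Gt : ℕ → X × U → ℝ≥0∞)
    (hG : ∀ p ≤ n, BddPos (G p)) (hGt : ∀ p ≤ n, BddPos (Gt p))
    (hunb : ∀ p ≤ n, ∀ x : X, ∫⁻ u, Gt p (x, u) ∂(K p x) = G p x)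
    (C : ℝ) (hC : 0 < C)
    (hs : ∀ p ≤ n, ∀ x : X, rwS n K G Gt p x ≤ ENNReal.ofReal (C + 1))
    (hZ : 0 < fkGamma M0 (fun q x => M q x) G n Set.univ) :
    ∑ p ∈ Finset.range (n + 1),
        ((fkGamma M0 (fun q x => M q x) G p Set.univ).toReal *
            (∫ x, (rwS n K G Gt p x).toReal *
              (∫ y, (1 : ℝ) ∂(fkQProd (fun q x => M q x) G n p x)) ^ 2
              ∂(fkGamma M0 (fun q x => M q x) G p)) /
            (fkGamma M0 (fun q x => M q x) G n Set.univ).toReal ^ 2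
          - (∫ x, (1 : ℝ) ∂(fkNorm (fkGamma M0 (fun q x => M q x) G n))) ^ 2)
      ≤ (C + 1) *
            ∑ p ∈ Finset.range (n + 1),
              ((fkGamma M0 (fun q x => M q x) G p Set.univ).toReal *
                  (∫ x, (∫ y, (1 : ℝ) ∂(fkQProd (fun q x => M q x) G n p x)) ^ 2
                    ∂(fkGamma M0 (fun q x => M q x) G p)) /
                  (fkGamma M0 (fun q x => M q x) G n Set.univ).toReal ^ 2
                - (∫ x, (1 : ℝ) ∂(fkNorm (fkGamma M0 (fun q x => M q x) G n))) ^ 2)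
        + (n : ℝ) * C := by
  have hfin : ∀ p ≤ n, IsFiniteMeasure (fkGamma M0 (fun q x => M q x) G p) :=
    fun p hp => ⟨fkGamma_univ_lt_top M0 M hG p hp⟩
  have := hfin n le_rfl
  have hη : ∫ x, (1 : ℝ) ∂(fkNorm (fkGamma M0 (fun q x => M q x) G n)) = 1 := by
    simp only [integral_const, smul_eq_mul, mul_one, Measure.real, fkNorm, Measure.smul_apply]
    rw [ENNReal.inv_mul_cancel hZ.ne' (measure_ne_top _ _), ENNReal.toReal_one]
  have hZr : 0 < (fkGamma M0 (fun q x => M q x) G n Set.univ).toReal :=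
    ENNReal.toReal_pos hZ.ne' (measure_ne_top _ _)
  rw [hη, Finset.sum_range_succ, Finset.sum_range_succ]
  have hlast : (fkGamma M0 (fun q x => M q x) G n Set.univ).toReal *
      (fkGamma M0 (fun q x => M q x) G n Set.univ).toReal /
      (fkGamma M0 (fun q x => M q x) G n Set.univ).toReal ^ 2 - 1 ^ 2 = 0 := by
    field_simp
    simp
  have hrest : ∀ p ∈ Finset.range n,
      (fkGamma M0 (fun q x => M q x) G p Set.univ).toReal *
            (∫ x, (rwS n K G Gt p x).toReal *
              (∫ y, (1 : ℝ) ∂(fkQProd (fun q x => M q x) G n p x)) ^ 2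
              ∂(fkGamma M0 (fun q x => M q x) G p)) /
            (fkGamma M0 (fun q x => M q x) G n Set.univ).toReal ^ 2 - 1 ^ 2
        ≤ (C + 1) * ((fkGamma M0 (fun q x => M q x) G p Set.univ).toReal *
            (∫ x, (∫ y, (1 : ℝ) ∂(fkQProd (fun q x => M q x) G n p x)) ^ 2
              ∂(fkGamma M0 (fun q x => M q x) G p)) /
            (fkGamma M0 (fun q x => M q x) G n Set.univ).toReal ^ 2 - 1 ^ 2) + C := by
    intro p hp
    have hpn : p ≤ n := (Finset.mem_range.mp hp).le
    have := hfin p hpn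
    have hint : ∫ x, (rwS n K G Gt p x).toReal *
          (∫ y, (1 : ℝ) ∂(fkQProd (fun q x => M q x) G n p x)) ^ 2
          ∂(fkGamma M0 (fun q x => M q x) G p)
        ≤ (C + 1) * ∫ x, (∫ y, (1 : ℝ) ∂(fkQProd (fun q x => M q x) G n p x)) ^ 2
          ∂(fkGamma M0 (fun q x => M q x) G p) := by
      rw [← integral_const_mul]
      refine integral_mono_of_nonneg (Filter.Eventually.of_forall fun x => by positivity)
        ((integrable_sq_integral_fkQProd M hG p _).const_mul _)
        (Filter.Eventually.of_forall fun x => ?_)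
      exact mul_le_mul_of_nonneg_right
        (ENNReal.toReal_le_of_le_ofReal (by linarith) (hs p hpn x)) (sq_nonneg _)
    have hscaled := div_le_div_of_nonneg_right
      (mul_le_mul_of_nonneg_left hint
        (ENNReal.toReal_nonneg (a := fkGamma M0 (fun q x => M q x) G p Set.univ)))
      (sq_nonneg (fkGamma M0 (fun q x => M q x) G n Set.univ).toReal)
    rw [mul_left_comm, mul_div_assoc (C + 1)] at hscaled
    linarith
  have hsum := Finset.sum_le_sum hrest
  rw [Finset.sum_add_distrib, ← Finset.mul_sum, Finset.sum_const, Finset.card_range,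
    nsmul_eq_mul] at hsum
  have hs_n : ∀ x, (rwS n K G Gt n x).toReal = 1 := fun x => by simp [rwS]
  have hQ_n : ∀ x, ∫ y, (1 : ℝ) ∂(fkQProd (fun q x => M q x) G n n x) = 1 := fun x => by
    simp [fkQProd, fkQProdAux]
  have hone : ∫ _, (1 : ℝ) ∂(fkGamma M0 (fun q x => M q x) G n) =
      (fkGamma M0 (fun q x => M q x) G n Set.univ).toReal := by
    simp [Measure.real]
  simp only [hs_n, hQ_n, one_mul, one_pow, hone] at hlast hsum ⊢
  rw [hlast]
  linarith

end
end
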